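/- Let 0 < e_0 ≤ 1, 1 ≤ m_1 ≤ m. For i ∈ Fin m with i < m_1 let A_i : ℝ → ℝ satisfy A_i(0) = 0 and e_0·(t − s) ≤ A_i(t) − A_i(s) ≤ t − s for all 0 ≤ s ≤ t; for the remaining i let A_i satisfy A_i(0) = 0, A_i(t) − A_i(s) ≤ t − s for 0 ≤ s ≤ t, A_i strictly increasing, and A_i(t) → ∞. Let g_i(w) = sInf {t ≥ 0 : A_i(t) ≥ w}, let p : Fin n → ℝ with p_j > 0, and let σ : Fin n → Fin m be an ECT schedule for the order 1, …, n, i.e., for every job k and every machine i, g_{σ k}(L_{σ k}^{<k}(σ) + p_k) ≤ g_i(L_i^{<k}(σ) + p_k), where L_i^{<k}(σ) = ∑_{j < k, σ j = i} p_j; the completion time of job k is C_k(σ) = g_{σ k}(L_{σ k}^{<k}(σ) + p_k). Let C* = min over all assignments τ of max_i g_i(∑_{j : τ j = i} p_j). If g_i(∑_{j : σ j = i} p_j) > C* for every machine i < m_1, then the number of jobs k with σ k < m_1 and C_k(σ) > C* is at most m − 1. -/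

import Mathlib

noncomputable def finish (A : ℝ → ℝ) (w : ℝ) : ℝ := sInf {t : ℝ | 0 ≤ t ∧ w ≤ A t}

noncomputable def load {n m : ℕ} (p : Fin n → ℝ) (σ : Fin n → Fin m) (i : Fin m) : ℝ :=
  ∑ j ∈ Finset.univ.filter (fun j => σ j = i), p j

noncomputable def prefLoad {n m : ℕ} (p : Fin n → ℝ) (σ : Fin n → Fin m) (i : Fin m)
    (k : Fin n) : ℝ :=
  ∑ j ∈ Finset.univ.filter (fun j => j < k ∧ σ j = i), p j

noncomputable def makespan {n m : ℕ} (hm : 0 < m) (A : Fin m → ℝ → ℝ) (p : Fin n → ℝ)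
    (σ : Fin n → Fin m) : ℝ :=
  Finset.univ.sup' ⟨⟨0, hm⟩, Finset.mem_univ _⟩ (fun i => finish (A i) (load p σ i))

noncomputable def optMakespan {n m : ℕ} (hm : 0 < m) (A : Fin m → ℝ → ℝ) (p : Fin n → ℝ) : ℝ :=
  Finset.univ.inf' ⟨fun _ => ⟨0, hm⟩, Finset.mem_univ _⟩ (makespan hm A p)

theorem finish_nonneg (A : ℝ → ℝ) (w : ℝ) : 0 ≤ finish A w :=
  Real.sInf_nonneg fun _ ht => ht.1

theorem lt_of_lt_finish {A : ℝ → ℝ} {w T : ℝ} (hT : 0 ≤ T) (h : T < finish A w) : A T < w := by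
  by_contra! hw
  exact h.not_ge (csInf_le ⟨0, fun _ ht => ht.1⟩ ⟨hT, hw⟩)

theorem le_of_finish_le {A : ℝ → ℝ} {w T : ℝ}
    (hub : ∀ s t : ℝ, 0 ≤ s → s ≤ t → A t - A s ≤ t - s)
    (hmono : MonotoneOn A (Set.Ici 0)) (hne : ∃ t, 0 ≤ t ∧ w ≤ A t)
    (hT : 0 ≤ T) (h : finish A w ≤ T) : w ≤ A T := by
  refine le_of_forall_pos_le_add fun ε hε => ?_
  obtain ⟨t, ⟨ht0, hwt⟩, ht⟩ :=
    exists_lt_of_csInf_lt (s := {t : ℝ | 0 ≤ t ∧ w ≤ A t}) hne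
      (lt_of_le_of_lt h (lt_add_of_pos_right T hε))
  rcases le_total t T with htT | htT
  · linarith [hmono ht0 hT htT]
  · linarith [hub T t hT htT]

theorem sum_load {n m : ℕ} (p : Fin n → ℝ) (τ : Fin n → Fin m) :
    ∑ i, load p τ i = ∑ j, p j :=
  Finset.sum_fiberwise _ _ _

theorem sum_prefLoad {n m : ℕ} (p : Fin n → ℝ) (σ : Fin n → Fin m) (f : Fin m → Fin n) :
    ∑ i, prefLoad p σ i (f i) = ∑ j with j < f (σ j), p j := by
  rw [← Finset.sum_fiberwise _ σ]
  refine Finset.sum_congr rfl fun i _ => ?_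
  rw [prefLoad, Finset.filter_filter]
  refine Finset.sum_congr (Finset.filter_congr fun j _ => ?_) fun _ _ => rfl
  constructor <;> rintro ⟨h, rfl⟩ <;> exact ⟨h, rfl⟩

/-- The last job on a nonempty machine sees the whole load of that machine. -/
theorem exists_prefLoad_add_eq_load {n m : ℕ} {p : Fin n → ℝ} {σ : Fin n → Fin m} {i : Fin m}
    (h : load p σ i ≠ 0) : ∃ k, σ k = i ∧ prefLoad p σ i k + p k = load p σ i := by
  have hne : (Finset.univ.filter fun j => σ j = i).Nonempty :=
    Finset.nonempty_of_sum_ne_zero h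
  obtain ⟨k, hk, hmax⟩ := Finset.exists_max_image _ id hne
  have hki : σ k = i := (Finset.mem_filter.1 hk).2
  refine ⟨k, hki, ?_⟩
  rw [load, ← Finset.sum_erase_add _ _ hk, prefLoad]
  congr 1
  refine Finset.sum_congr (Finset.ext fun j => ?_) fun _ _ => rfl
  simp only [Finset.mem_filter, Finset.mem_univ, true_and, Finset.mem_erase]
  exact ⟨fun hj => ⟨hj.1.ne, hj.2⟩,
    fun hj => ⟨lt_of_le_of_ne (hmax j (by simpa using hj.2)) hj.1, hj.2⟩⟩

/-- Distinct jobs `f i`, none of which precedes the job selected for its own machine, can be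
appended to the prefixes they see without counting any job twice. -/
theorem sum_prefLoad_add_le {n m : ℕ} {p : Fin n → ℝ} (hp : ∀ j, 0 ≤ p j) (σ : Fin n → Fin m)
    {f : Fin m → Fin n} (hf : Function.Injective f) (hle : ∀ i, f (σ (f i)) ≤ f i) :
    ∑ i, (prefLoad p σ i (f i) + p (f i)) ≤ ∑ j, p j := by
  rw [Finset.sum_add_distrib, sum_prefLoad, ← Finset.sum_image (f := p) hf.injOn,
    ← Finset.sum_union]
  · exact Finset.sum_le_univ_sum_of_nonneg hp
  · rw [Finset.disjoint_left]
    intro j hj hj'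
    obtain ⟨i, -, rfl⟩ := Finset.mem_image.1 hj'
    exact (Finset.mem_filter.1 hj).2.not_ge (hle i)

theorem stmt_7 (e0 : ℝ) (he0 : 0 < e0) (he0' : e0 ≤ 1)
    (m m1 n : ℕ) (hm1 : 1 ≤ m1) (hm1m : m1 ≤ m)
    (A : Fin m → ℝ → ℝ) (hA0 : ∀ i, A i 0 = 0)
    (hAub : ∀ i, ∀ s t : ℝ, 0 ≤ s → s ≤ t → A i t - A i s ≤ t - s)
    (hAlo : ∀ i : Fin m, (i : ℕ) < m1 →
      ∀ s t : ℝ, 0 ≤ s → s ≤ t → e0 * (t - s) ≤ A i t - A i s)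
    (hmono : ∀ i : Fin m, m1 ≤ (i : ℕ) → StrictMonoOn (A i) (Set.Ici (0 : ℝ)))
    (htop : ∀ i : Fin m, m1 ≤ (i : ℕ) → Filter.Tendsto (A i) Filter.atTop Filter.atTop)
    (p : Fin n → ℝ) (hp : ∀ j, 0 < p j)
    (σ : Fin n → Fin m)
    (hECT : ∀ k : Fin n, ∀ i : Fin m,
      finish (A (σ k)) (prefLoad p σ (σ k) k + p k) ≤ finish (A i) (prefLoad p σ i k + p k))
    (hbusy : ∀ i : Fin m, (i : ℕ) < m1 →
      optMakespan (lt_of_lt_of_le hm1 hm1m) A p < finish (A i) (load p σ i)) :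
    {k : Fin n | (σ k : ℕ) < m1 ∧
        optMakespan (lt_of_lt_of_le hm1 hm1m) A p
          < finish (A (σ k)) (prefLoad p σ (σ k) k + p k)}.ncard ≤ m - 1 := by
  classical
  have hm : 0 < m := lt_of_lt_of_le hm1 hm1m
  set T := optMakespan hm A p with hTdef
  obtain ⟨τ, -, hτ⟩ := Finset.exists_mem_eq_inf'
    (s := (Finset.univ : Finset (Fin n → Fin m))) ⟨fun _ => ⟨0, hm⟩, Finset.mem_univ _⟩
    (makespan hm A p)
  have hτT : ∀ i, finish (A i) (load p τ i) ≤ T := fun i =>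
    (Finset.le_sup' (fun i => finish (A i) (load p τ i)) (Finset.mem_univ i)).trans hτ.ge
  have hT : 0 ≤ T := (finish_nonneg _ _).trans (hτT ⟨0, hm⟩)
  have hmonoA : ∀ i, MonotoneOn (A i) (Set.Ici 0) := fun i => by
    rcases lt_or_ge (i : ℕ) m1 with hi | hi
    · intro s hs t _ hst
      nlinarith [hAlo i hi s t hs hst]
    · exact (hmono i hi).monotoneOn
  have hreach : ∀ i w, ∃ t, 0 ≤ t ∧ w ≤ A i t := fun i w => by
    rcases lt_or_ge (i : ℕ) m1 with hi | hi
    · refine ⟨|w| / e0, by positivity, ?_⟩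
      have h := hAlo i hi 0 (|w| / e0) le_rfl (by positivity)
      rw [hA0, sub_zero, sub_zero, mul_div_cancel₀ _ he0.ne'] at h
      exact (le_abs_self w).trans h
    · exact ((Filter.eventually_ge_atTop 0).and ((htop i hi).eventually_ge_atTop w)).exists
  have hcap : ∑ j, p j ≤ ∑ i, A i T := by
    rw [← sum_load p τ]
    exact Finset.sum_le_sum fun i _ =>
      le_of_finish_le (hAub i) (hmonoA i) (hreach i _) hT (hτT i)
  set K : Finset (Fin n) := Finset.univ.filter fun k => (σ k : ℕ) < m1 ∧
    T < finish (A (σ k)) (prefLoad p σ (σ k) k + p k) with hK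
  have hfirst : ∀ i : Fin m, (i : ℕ) < m1 →
      ∃ k ∈ K, σ k = i ∧ ∀ j ∈ K, σ j = i → k ≤ j := fun i hi => by
    have hload : load p σ i ≠ 0 := by
      have h0 := hmonoA i Set.self_mem_Ici hT hT
      rw [hA0] at h0
      exact (h0.trans_lt (lt_of_lt_finish hT (hbusy i hi))).ne'
    obtain ⟨k, rfl, hk⟩ := exists_prefLoad_add_eq_load hload
    have hkK : k ∈ K.filter fun j => σ j = σ k := by
      simp only [hK, Finset.mem_filter, Finset.mem_univ, true_and, and_true]
      exact ⟨hi, hk ▸ hbusy _ hi⟩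
    obtain ⟨l, hl, hmin⟩ := Finset.exists_min_image _ id ⟨k, hkK⟩
    obtain ⟨hlK, hlk⟩ := Finset.mem_filter.1 hl
    exact ⟨l, hlK, hlk, fun j hj hji => hmin j (Finset.mem_filter.2 ⟨hj, hji⟩)⟩
  rw [show {k : Fin n | (σ k : ℕ) < m1 ∧
    T < finish (A (σ k)) (prefLoad p σ (σ k) k + p k)} = (K : Set (Fin n)) by simp [hK],
    Set.ncard_coe_finset]
  by_contra! hcard
  have : Nonempty (Fin n) := (hfirst ⟨0, hm⟩ hm1).nonempty
  choose! first hfirstK hfirstσ hfirstle using hfirst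
  have hinj : Set.InjOn first {i : Fin m | (i : ℕ) < m1} := fun i hi j hj hij => by
    rw [← hfirstσ i hi, hij, hfirstσ j hj]
  set S : Finset (Fin m) := Finset.univ.filter fun i : Fin m => (i : ℕ) < m1 with hS
  have himage : S.image first ⊆ K := Finset.image_subset_iff.2 fun i hi =>
    hfirstK i (Finset.mem_filter.1 hi).2
  obtain ⟨t, hSt, htK, ht⟩ := Finset.exists_subsuperset_card_eq (n := m) himage
    (Finset.card_image_le.trans ((Finset.card_le_univ S).trans (Fintype.card_fin m).le))
    (by omega)
  obtain ⟨g, hg⟩ := Set.MapsTo.exists_equiv_extend_of_card_eq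
    (s := {i : Fin m | (i : ℕ) < m1}) (f := first) (t := t) (by simp [ht])
    (fun i hi => hSt (Finset.mem_image_of_mem _ (Finset.mem_filter.2 ⟨Finset.mem_univ _, hi⟩)))
    hinj
  have hgK : ∀ i, (g i : Fin n) ∈ K := fun i => htK (g i).2
  have hlate : ∀ i, A i T < prefLoad p σ i (g i) + p (g i) := fun i =>
    lt_of_lt_finish hT ((Finset.mem_filter.1 (hgK i)).2.2.trans_le (hECT _ i))
  have hsum := sum_prefLoad_add_le (fun j => (hp j).le) σ
    (f := fun i => (g i : Fin n)) (Subtype.val_injective.comp g.injective) fun i => by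
      have hi := (Finset.mem_filter.1 (hgK i)).2.1
      simpa only [hg _ hi] using hfirstle _ hi _ (hgK i) rfl
  have hlt : ∑ i, A i T < ∑ i, (prefLoad p σ i (g i) + p (g i)) :=
    Finset.sum_lt_sum_of_nonempty ⟨⟨0, hm⟩, Finset.mem_univ _⟩ fun i _ => hlate i
  exact (hcap.trans_lt hlt).not_ge hsum
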